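/- Let n be even, let e : ℝᵈ → M_N(ℂ) be a smooth map taking values in self-adjoint idempotent matrices (e(x)² = e(x) = e(x)*), let x₀ ∈ ℝᵈ and v₁, …, vₙ ∈ ℝᵈ. Define, for (ε₁,…,εₙ) in a sufficiently small neighborhood of 0 in ℝⁿ, f(ε₁,…,εₙ) = Chⁿ( e(x₀), e(x₀+ε₁v₁), …, e(x₀+εₙvₙ) ). Then ∂ⁿf/∂ε₁⋯∂εₙ |_{ε=0} = bₙ · (1/n!) · Σ_{σ∈Sₙ} sgn(σ) tr( e(x₀) (D_{v_{σ(1)}}e)(x₀) ⋯ (D_{v_{σ(n)}}e)(x₀) ), where D_v denotes the directional derivative along v. Hence the image of the Alexander–Spanier cochain Chⁿ under the canonical map to de Rham forms is the Chern–Weil form bₙ Tr e(de)ⁿ. -/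

import Mathlib

open scoped Matrix.Norms.L2Operator
open Matrix MeasureTheory

/-- The standard `n`-simplex `Δⁿ = {t ∈ ℝⁿ : tᵢ ≥ 0, Σᵢ tᵢ ≤ 1}`. -/
def simplexΔ (n : ℕ) : Set (Fin n → ℝ) := {t | (∀ i, 0 ≤ t i) ∧ ∑ i, t i ≤ 1}

/-- `a(t) = Σⱼ₌₀ⁿ tⱼ eⱼ`, with `t₀ = 1 − Σᵢ₌₁ⁿ tᵢ`. -/
noncomputable def simplexComb {n N : ℕ} (e : Fin (n + 1) → Matrix (Fin N) (Fin N) ℂ)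
    (t : Fin n → ℝ) : Matrix (Fin N) (Fin N) ℂ :=
  (((1 - ∑ i, t i : ℝ)) : ℂ) • e 0 + ∑ i : Fin n, ((t i : ℝ) : ℂ) • e i.succ

/-- The Riesz (spectral) projector `E(t) = (1/2πi) ∮_{|λ−1|=1/2} (λ·1 − a(t))⁻¹ dλ`
onto the part of the spectrum of `a(t) = Σⱼ tⱼ eⱼ` near `1`. -/
noncomputable def rieszComb {n N : ℕ} (e : Fin (n + 1) → Matrix (Fin N) (Fin N) ℂ)
    (t : Fin n → ℝ) : Matrix (Fin N) (Fin N) ℂ :=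
  (2 * Real.pi * Complex.I)⁻¹ •
    ∮ z in C(1, 1 / 2), (z • (1 : Matrix (Fin N) (Fin N) ℂ) - simplexComb e t)⁻¹

/-- The constant `bₙ = (−1)^(n/2) / ((2πi)^(n/2) (n/2)!)`. -/
noncomputable def evenChernConst (n : ℕ) : ℂ :=
  (-1) ^ (n / 2) / ((2 * Real.pi * Complex.I) ^ (n / 2) * (Nat.factorial (n / 2) : ℂ))

/-- The even Chern character cochain
`Chⁿ(e₀,…,eₙ) = bₙ ∫_{Δⁿ} Σ_{σ∈Sₙ} sgn σ · tr(E(t) ∂E/∂t_{σ(1)} ⋯ ∂E/∂t_{σ(n)}) dt`. -/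
noncomputable def chEven (n N : ℕ) (e : Fin (n + 1) → Matrix (Fin N) (Fin N) ℂ) : ℂ :=
  evenChernConst n *
    ∫ t in simplexΔ n, ∑ σ : Equiv.Perm (Fin n),
      ((Equiv.Perm.sign σ : ℤ) : ℂ) *
        Matrix.trace
          (rieszComb e t *
            (((List.finRange n).map fun i =>
              fderiv ℝ (rieszComb e) t (Pi.single (σ i) 1)).prod))


section helpers
open Filter Topology
open scoped ContDiff

theorem param_step {E T G : Type} [NormedAddCommGroup E] [NormedSpace ℝ E]
    [NormedAddCommGroup T] [NormedSpace ℝ T] [MeasurableSpace T] [BorelSpace T]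
    [SecondCountableTopology T] [NormedAddCommGroup G] [NormedSpace ℝ G]
    (μ : Measure T) [IsFiniteMeasureOnCompacts μ] {K : Set T} (hK : IsCompact K)
    (F : E → T → G) (x₀ : E)
    (h : ∀ᶠ x in 𝓝 x₀, ∀ t ∈ K, ContDiffAt ℝ ∞ (Function.uncurry F) (x, t)) :
    HasFDerivAt (fun x => ∫ t in K, F x t ∂μ)
      (∫ t in K, fderiv ℝ (fun y => F y t) x₀ ∂μ) x₀ := by
  have h0 := h.self_of_nhds
  have hcd : ∀ x : E, ∀ t : T, ContDiffAt ℝ ∞ (Function.uncurry F) (x, t) →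
      ContDiffAt ℝ ∞ (fun p : E × T => fderiv ℝ (fun y => F y p.2) p.1) (x, t) := by
    intro x t hx
    refine ContDiffAt.fderiv (n := ∞) (f := fun (p : E × T) y => F y p.2) (g := fun p => p.1) ?_
      contDiffAt_fst (by simp)
    exact ContDiffAt.comp (g := Function.uncurry F) (f := fun q : (E × T) × E => (q.2, q.1.2))
      ((x, t), x) hx (by fun_prop)
  have hc1 : ∀ x, (∀ t ∈ K, ContDiffAt ℝ ∞ (Function.uncurry F) (x, t)) →
      ContinuousOn (F x) K := by
    intro x hx t ht
    have := (hx t ht).continuousAt.comp (f := fun t => (x, t)) (by fun_prop)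
    exact this.continuousWithinAt
  have hc2 : ContinuousOn (fun t => fderiv ℝ (fun y => F y t) x₀) K := by
    intro t ht
    have := (hcd x₀ t (h0 t ht)).continuousAt.comp (f := fun t => (x₀, t)) (by fun_prop)
    exact this.continuousWithinAt
  obtain ⟨C, hC⟩ := hK.exists_bound_of_continuousOn hc2
  have hb : ∀ᶠ x in 𝓝 x₀, ∀ t ∈ K, ‖fderiv ℝ (fun y => F y t) x‖ ≤ C + 1 := by
    apply hK.eventually_forall_of_forall_eventually
    intro t ht
    have := (hcd x₀ t (h0 t ht)).continuousAt.norm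
    have hlt : ‖fderiv ℝ (fun y => F y t) x₀‖ < C + 1 := (hC t ht).trans_lt (by linarith)
    exact (this.eventually (gt_mem_nhds hlt)).mono fun p hp => le_of_lt hp
  have hm : MeasurableSet K := hK.isClosed.measurableSet
  have hd : ∀ᶠ x in 𝓝 x₀, ∀ t ∈ K,
      HasFDerivAt (fun y => F y t) (fderiv ℝ (fun y => F y t) x) x := by
    refine h.mono fun x hx t ht => ?_
    have : ContDiffAt ℝ ∞ (fun y => F y t) x :=
      (hx t ht).comp (f := fun y => (y, t)) x (by fun_prop)
    exact (this.differentiableAt (by simp)).hasFDerivAt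
  refine hasFDerivAt_integral_of_dominated_of_fderiv_le (𝕜 := ℝ) (bound := fun _ => C + 1)
    (F := F) (F' := fun x t => fderiv ℝ (fun y => F y t) x) (μ := μ.restrict K)
    (hb.and hd) ?_ ?_ ?_ ?_ ?_ ?_
  · exact h.mono fun x hx => (hc1 x hx).aestronglyMeasurable hm
  · exact (hc1 x₀ h0).integrableOn_compact hK
  · exact hc2.aestronglyMeasurable hm
  · exact (ae_restrict_mem hm).mono fun t ht x hx => hx.1 t ht
  · exact (continuousOn_const (c := C + 1)).integrableOn_compact hK
  · exact (ae_restrict_mem hm).mono fun t ht x hx => hx.2 t ht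

theorem param_nat {E T : Type} [NormedAddCommGroup E] [NormedSpace ℝ E]
    [NormedAddCommGroup T] [NormedSpace ℝ T] [MeasurableSpace T] [BorelSpace T]
    [SecondCountableTopology T] 
    (μ : Measure T) [IsFiniteMeasureOnCompacts μ] {K : Set T} (hK : IsCompact K) {U : Set E}
    (hU : IsOpen U) (k : ℕ) :
    ∀ {G : Type} [NormedAddCommGroup G] [NormedSpace ℝ G] (F : E → T → G)
    (_ : ∀ x ∈ U, ∀ t ∈ K, ContDiffAt ℝ ∞ (Function.uncurry F) (x, t)),
    ContDiffOn ℝ k (fun x => ∫ t in K, F x t ∂μ) U := by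
  induction k with
  | zero =>
    intro G _ _ F h
    simp only [Nat.cast_zero, contDiffOn_zero]
    intro x hx
    exact (param_step μ hK F x ((hU.eventually_mem hx).mono h)).continuousAt.continuousWithinAt
  | succ k ih =>
    intro G _ _ F h
    have hstep := fun x hx => param_step μ hK F x ((hU.eventually_mem hx).mono h)
    push_cast
    rw [contDiffOn_succ_iff_hasFDerivWithinAt_of_uniqueDiffOn hU.uniqueDiffOn]
    refine ⟨by simp, fun x => ∫ t in K, fderiv ℝ (fun y => F y t) x ∂μ, ?_,
      fun x hx => (hstep x hx).hasFDerivWithinAt⟩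
    apply ih (fun x t => fderiv ℝ (fun y => F y t) x)
    intro x hx t ht
    refine ContDiffAt.fderiv (n := ∞) (f := fun (p : E × T) y => F y p.2) (g := fun p => p.1) ?_
      contDiffAt_fst (by simp)
    exact ContDiffAt.comp (g := Function.uncurry F) (f := fun q : (E × T) × E => (q.2, q.1.2))
      ((x, t), x) (h x hx t ht) (by fun_prop)

theorem param_smooth {E T G : Type} [NormedAddCommGroup E] [NormedSpace ℝ E]
    [NormedAddCommGroup T] [NormedSpace ℝ T] [MeasurableSpace T] [BorelSpace T]
    [SecondCountableTopology T] [NormedAddCommGroup G] [NormedSpace ℝ G]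
    (μ : Measure T) [IsFiniteMeasureOnCompacts μ] {K : Set T} (hK : IsCompact K)
    (F : E → T → G) (x₀ : E)
    (h : ∀ᶠ x in 𝓝 x₀, ∀ t ∈ K, ContDiffAt ℝ ∞ (Function.uncurry F) (x, t)) :
    ∀ᶠ x in 𝓝 x₀, ContDiffAt ℝ ∞ (fun x => ∫ t in K, F x t ∂μ) x := by
  obtain ⟨U, hUF, hU, hx⟩ := eventually_nhds_iff.1 h
  refine (hU.eventually_mem hx).mono fun x hx => ?_
  refine contDiffAt_infty.2 fun k => ?_
  exact (param_nat μ hK hU k F hUF).contDiffAt (hU.mem_nhds hx)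

theorem mixed_partial {n : ℕ} : ∀ (k : ℕ) (idx : Fin k → Fin n) (_ : Function.Injective idx)
    (f H : (Fin n → ℝ) → ℂ) (_ : ContDiffAt ℝ ∞ H 0)
    (_ : f =ᶠ[𝓝 0] fun ε => (∏ i, ε (idx i)) • H ε),
    iteratedFDeriv ℝ k f 0 (fun i => Pi.single (idx i) 1) = H 0 := by
  intro k
  induction k with
  | zero =>
    intro idx _ f H hH hf
    simpa using hf.self_of_nhds
  | succ k ih =>
    intro idx hidx f H hH hf
    set j := idx (Fin.last k) with hj
    have hfs : ContDiffAt ℝ ∞ f 0 := by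
      refine ContDiffAt.congr_of_eventuallyEq ?_ hf
      have hP : ContDiffAt ℝ ∞ (fun ε : Fin n → ℝ => ∏ i, ε (idx i)) 0 := by fun_prop
      exact hP.smul hH
    have hfd : ContDiffAt ℝ ∞ (fderiv ℝ f) 0 := hfs.fderiv_right (by simp)
    rw [iteratedFDeriv_succ_apply_right]
    let L : ((Fin n → ℝ) →L[ℝ] ℂ) →L[ℝ] ℂ :=
      ContinuousLinearMap.apply ℝ ℂ (Pi.single j (1 : ℝ))
    have h1 := L.iteratedFDeriv_comp_left (i := k) hfd (by exact_mod_cast le_top)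
    have h2 := congrArg (fun M => M (fun i : Fin k => Pi.single (idx i.castSucc) (1 : ℝ))) h1
    simp only [ContinuousLinearMap.compContinuousMultilinearMap_coe, Function.comp_apply] at h2
    refine Eq.trans h2.symm ?_
    have h3 := ih (fun i => idx i.castSucc) (fun a b hab => Fin.castSucc_injective _ (hidx hab))
      (L ∘ fderiv ℝ f) (fun ε => H ε + ε j • fderiv ℝ H ε (Pi.single j 1)) ?_ ?_
    · simpa using h3
    · have : ContDiffAt ℝ ∞ (fderiv ℝ H) 0 := hH.fderiv_right (by simp)
      fun_prop
    · have hd : ∀ᶠ ε in 𝓝 (0 : Fin n → ℝ), DifferentiableAt ℝ H ε := by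
        have := (hH.of_le (m := 1) (by simp)).eventually (by simp)
        exact this.mono fun ε h => h.differentiableAt (by simp)
      filter_upwards [hd, hf.eventuallyEq_nhds] with ε hε hfe
      have hp : HasFDerivAt (fun ε : Fin n → ℝ => ε j) (ContinuousLinearMap.proj (R := ℝ) j) ε :=
        (ContinuousLinearMap.proj (R := ℝ) (φ := fun _ : Fin n => ℝ) j).hasFDerivAt
      -- use line derivative along single j
      have hD : DifferentiableAt ℝ (fun ε : Fin n → ℝ => ∏ i : Fin k, ε (idx i.castSucc)) ε := by
        fun_prop
      have hD0 : fderiv ℝ (fun ε : Fin n → ℝ => ∏ i : Fin k, ε (idx i.castSucc)) ε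
          (Pi.single j 1) = 0 := by
        rw [← hD.lineDeriv_eq_fderiv]
        unfold lineDeriv
        have : (fun t : ℝ => ∏ i : Fin k, (ε + t • (Pi.single j (1 : ℝ) : Fin n → ℝ)) (idx i.castSucc))
            = fun _ => ∏ i : Fin k, ε (idx i.castSucc) := by
          funext t
          refine Finset.prod_congr rfl fun i _ => ?_
          have : idx i.castSucc ≠ j := by
            intro hh
            exact (Fin.castSucc_lt_last i).ne (hidx hh)
          simp [Pi.single_eq_of_ne this]
        rw [this]; simp
      have hfe2 : f =ᶠ[𝓝 ε] fun ε => (∏ i : Fin k, ε (idx i.castSucc)) • (ε j • H ε) := by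
        refine hfe.trans (Eventually.of_forall fun y => ?_)
        simp only [Fin.prod_univ_castSucc, smul_smul, hj]
      have hmain := hD.hasFDerivAt.smul (hp.smul hε.hasFDerivAt)
      have hff := hmain.congr_of_eventuallyEq hfe2
      simp only [Function.comp_apply, L, ContinuousLinearMap.apply_apply]
      rw [hff.fderiv]
      simp [hD0]
      ring
end helpers
section riesz
open Filter Topology
open scoped ContDiff

variable {A : Type} [NormedRing A] [NormedAlgebra ℂ A] [CompleteSpace A]

/-- The Riesz projector functional on a Banach algebra. -/
noncomputable def rieszF (a : A) : A :=
  (2 * Real.pi * Complex.I)⁻¹ • ∮ z in C(1, 1 / 2), Ring.inverse (z • (1 : A) - a)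

set_option linter.unusedSectionVars false

theorem resolvent_idem {e : A} (he : e * e = e) {z : ℂ} (h0 : z ≠ 0) (h1 : z - 1 ≠ 0) :
    (z • (1 : A) - e) * (z⁻¹ • (1 - e) + (z - 1)⁻¹ • e) = 1 ∧
    (z⁻¹ • (1 - e) + (z - 1)⁻¹ • e) * (z • (1 : A) - e) = 1 := by
  constructor
  · simp only [mul_add, sub_mul, mul_sub, smul_mul_assoc, mul_smul_comm, one_mul, mul_one, he,
      smul_sub]
    match_scalars <;> field_simp <;> ring
  · simp only [add_mul, sub_mul, mul_sub, smul_mul_assoc, mul_smul_comm, one_mul, mul_one, he,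
      smul_sub]
    match_scalars <;> field_simp <;> ring

theorem circle_ne {z : ℂ} (hz : z ∈ Metric.sphere (1 : ℂ) (1 / 2)) : z ≠ 0 ∧ z - 1 ≠ 0 := by
  rw [mem_sphere_iff_norm] at hz
  constructor
  · rintro rfl; norm_num at hz
  · intro h; rw [h] at hz; norm_num at hz

theorem resolvent_inverse {e : A} (he : e * e = e) {z : ℂ}
    (hz : z ∈ Metric.sphere (1 : ℂ) (1 / 2)) :
    IsUnit (z • (1 : A) - e) ∧
    Ring.inverse (z • (1 : A) - e) = z⁻¹ • (1 - e) + (z - 1)⁻¹ • e := by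
  obtain ⟨h0, h1⟩ := circle_ne hz
  obtain ⟨ha, hb⟩ := resolvent_idem he h0 h1
  let u : Aˣ := ⟨_, _, ha, hb⟩
  exact ⟨u.isUnit, Ring.inverse_unit u⟩

theorem rieszF_idem {e : A} (he : e * e = e) : rieszF e = e := by
  unfold rieszF
  have h1 : (∮ z in C(1, 1 / 2), Ring.inverse (z • (1 : A) - e)) =
      ∮ z in C(1, 1 / 2), (z⁻¹ • (1 - e) + (z - 1)⁻¹ • e) :=
    circleIntegral.integral_congr (by norm_num) fun z hz => (resolvent_inverse he hz).2
  have hc0 : ContinuousOn (fun z : ℂ => z⁻¹) (Metric.sphere (1 : ℂ) (1 / 2)) :=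
    ContinuousOn.inv₀ continuousOn_id fun z hz => (circle_ne hz).1
  have hc1 : ContinuousOn (fun z : ℂ => (z - 1)⁻¹) (Metric.sphere (1 : ℂ) (1 / 2)) :=
    ContinuousOn.inv₀ (by fun_prop) fun z hz => (circle_ne hz).2
  have hi0 : CircleIntegrable (fun z : ℂ => z⁻¹ • (1 - e)) 1 (1 / 2) :=
    ContinuousOn.circleIntegrable (by norm_num) (hc0.smul continuousOn_const)
  have hi1 : CircleIntegrable (fun z : ℂ => (z - 1)⁻¹ • e) 1 (1 / 2) :=
    ContinuousOn.circleIntegrable (by norm_num) (hc1.smul continuousOn_const)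
  rw [h1, circleIntegral.integral_add hi0 hi1,
    circleIntegral.integral_smul_const, circleIntegral.integral_smul_const,
    circleIntegral.integral_sub_center_inv 1 (by norm_num)]
  have hz : (∮ z in C(1, 1 / 2), (z : ℂ)⁻¹) = 0 := by
    apply DiffContOnCl.circleIntegral_eq_zero (by norm_num)
    apply DifferentiableOn.diffContOnCl
    rw [closure_ball _ (by norm_num)]
    intro z hz
    refine (differentiableAt_inv ?_).differentiableWithinAt
    rintro rfl
    norm_num [Metric.mem_closedBall, dist_eq_norm] at hz
  rw [hz, zero_smul, zero_add, smul_smul, inv_mul_cancel₀ Complex.two_pi_I_ne_zero, one_smul]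

theorem rieszF_smooth {e : A} (he : e * e = e) :
    ∀ᶠ a in 𝓝 e, ContDiffAt ℝ ∞ (rieszF (A := A)) a := by
  have hrw : (rieszF (A := A)) = fun a => (2 * Real.pi * Complex.I)⁻¹ •
      ∫ θ in Set.Icc (0 : ℝ) (2 * Real.pi), deriv (circleMap 1 (1 / 2)) θ •
        Ring.inverse (circleMap 1 (1 / 2) θ • (1 : A) - a) := by
    funext a
    rw [integral_Icc_eq_integral_Ioc, ← intervalIntegral.integral_of_le Real.two_pi_pos.le]
    rfl
  have hcm : ContDiff ℝ ∞ (circleMap (1 : ℂ) (1 / 2)) := contDiff_circleMap _ _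
  have hev : ∀ᶠ a in 𝓝 e, ∀ θ ∈ Set.Icc (0 : ℝ) (2 * Real.pi),
      IsUnit (circleMap 1 (1 / 2) θ • (1 : A) - a) := by
    apply isCompact_Icc.eventually_forall_of_forall_eventually
    intro θ _
    have hu := (resolvent_inverse he (circleMap_mem_sphere (1 : ℂ) (by norm_num : (0:ℝ) ≤ 1 / 2) θ)).1
    have hcont : Continuous fun p : A × ℝ => circleMap 1 (1 / 2) p.2 • (1 : A) - p.1 := by
      fun_prop
    exact hcont.continuousAt.eventually (Units.isOpen.mem_nhds hu)
  have := param_smooth (volume : Measure ℝ)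
    (isCompact_Icc (a := (0 : ℝ)) (b := 2 * Real.pi)) (fun (a : A) θ =>
    deriv (circleMap 1 (1 / 2)) θ • Ring.inverse (circleMap 1 (1 / 2) θ • (1 : A) - a)) e
    (hev.mono fun a ha θ hθ => ?_)
  · rw [hrw]
    exact this.mono fun a ha => ha.const_smul _
  · obtain ⟨u, hu⟩ := ha θ hθ
    have h1 : ContDiffAt ℝ ∞ (fun p : A × ℝ => circleMap 1 (1 / 2) p.2 • (1 : A) - p.1) (a, θ) := by
      fun_prop
    have h2 : ContDiffAt ℝ ∞ (Ring.inverse : A → A) (circleMap 1 (1 / 2) θ • (1 : A) - a) := by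
      rw [← hu]; exact contDiffAt_ringInverse ℝ u
    have h3 := ContDiffAt.comp (g := (Ring.inverse : A → A)) (a, θ) h2 h1
    have h4 : ContDiffAt ℝ ∞ (fun p : A × ℝ => deriv (circleMap 1 (1 / 2)) p.2) (a, θ) := by
      simp only [deriv_circleMap]
      have : ContDiff ℝ ∞ (circleMap (0 : ℂ) (1 / 2)) := contDiff_circleMap _ _
      fun_prop
    exact h4.smul h3
end riesz
section simplexvol

theorem isClosed_simplex (n : ℕ) (r : ℝ) :
    IsClosed {t : Fin n → ℝ | (∀ i, 0 ≤ t i) ∧ ∑ i, t i ≤ r} := by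
  refine IsClosed.inter (s₁ := {t : Fin n → ℝ | ∀ i, 0 ≤ t i})
    (s₂ := {t : Fin n → ℝ | ∑ i, t i ≤ r}) ?_ (isClosed_le (by fun_prop) (by fun_prop))
  rw [Set.ofPred_forall]
  exact isClosed_iInter fun i => isClosed_le (by fun_prop) (by fun_prop)

theorem isCompact_simplexΔ (n : ℕ) : IsCompact (simplexΔ n) := by
  refine IsCompact.of_isClosed_subset (isCompact_Icc (a := (0 : Fin n → ℝ)) (b := 1))
    (isClosed_simplex n 1) ?_
  rintro t ⟨h0, h1⟩
  refine ⟨fun i => h0 i, fun i => ?_⟩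
  exact (Finset.single_le_sum (fun j _ => h0 j) (Finset.mem_univ i)).trans h1

theorem volume_simplex (n : ℕ) : ∀ r : ℝ, 0 ≤ r →
    volume {t : Fin n → ℝ | (∀ i, 0 ≤ t i) ∧ ∑ i, t i ≤ r}
      = ENNReal.ofReal (r ^ n / (Nat.factorial n : ℝ)) := by
  induction n with
  | zero =>
    intro r hr
    have : {t : Fin 0 → ℝ | (∀ i, 0 ≤ t i) ∧ ∑ i, t i ≤ r} = Set.univ := by
      ext t; simp [hr]
    rw [this, volume_pi, Measure.pi_of_empty]; simp
  | succ n ih =>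
    intro r hr
    have hmp := (volume_preserving_piFinSuccAbove (fun _ : Fin (n + 1) => ℝ) 0).symm
    have hms := (isClosed_simplex (n + 1) r).measurableSet
    rw [← hmp.measure_preimage_equiv, Measure.volume_eq_prod,
      Measure.prod_apply (hmp.measurable hms)]
    have hsl : ∀ x : ℝ, volume (Prod.mk x ⁻¹'
        ((MeasurableEquiv.piFinSuccAbove (fun _ : Fin (n + 1) => ℝ) 0).symm ⁻¹'
          {t : Fin (n + 1) → ℝ | (∀ i, 0 ≤ t i) ∧ ∑ i, t i ≤ r})) =
        (Set.Icc 0 r).indicator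
          (fun x => ENNReal.ofReal ((r - x) ^ n / (Nat.factorial n : ℝ))) x := by
      intro x
      have hset : Prod.mk x ⁻¹'
        ((MeasurableEquiv.piFinSuccAbove (fun _ : Fin (n + 1) => ℝ) 0).symm ⁻¹'
          {t : Fin (n + 1) → ℝ | (∀ i, 0 ≤ t i) ∧ ∑ i, t i ≤ r}) =
          {t : Fin n → ℝ | 0 ≤ x ∧ (∀ i, 0 ≤ t i) ∧ ∑ i, t i ≤ r - x} := by
        ext t
        simp [MeasurableEquiv.piFinSuccAbove, Fin.forall_fin_succ, Fin.sum_univ_succ, and_assoc,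
          le_sub_iff_add_le, add_comm]
      rw [hset]
      by_cases hx : x ∈ Set.Icc 0 r
      · rw [Set.indicator_of_mem hx, ← ih (r - x) (by linarith [hx.2])]
        simp [hx.1]
      · rw [Set.indicator_of_notMem hx]
        convert measure_empty (μ := (volume : Measure (Fin n → ℝ)))
        ext t
        simp only [Set.mem_ofPred_eq, Set.mem_empty_iff_false, iff_false]
        rintro ⟨h0, h1, h2⟩
        exact hx ⟨h0, by linarith [Finset.sum_nonneg fun i (_ : i ∈ Finset.univ) => h1 i]⟩
    simp_rw [hsl]
    rw [lintegral_indicator measurableSet_Icc, ← ofReal_integral_eq_lintegral_ofReal]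
    · congr 1
      rw [integral_Icc_eq_integral_Ioc, ← intervalIntegral.integral_of_le hr,
        intervalIntegral.integral_comp_sub_left (fun y => y ^ n / (Nat.factorial n : ℝ)) r,
        intervalIntegral.integral_div, integral_pow, Nat.factorial_succ]
      have := Nat.factorial_ne_zero n
      push_cast
      field_simp
      simp
    · exact (by fun_prop : Continuous fun x : ℝ => (r - x) ^ n / (Nat.factorial n : ℝ)).integrableOn_Icc
    · refine (ae_restrict_mem measurableSet_Icc).mono fun x hx => ?_
      have : 0 ≤ r - x := by linarith [hx.2]
      simp only [Pi.zero_apply]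
      positivity

theorem volume_real_simplexΔ (n : ℕ) :
    (volume : Measure (Fin n → ℝ)).real (simplexΔ n) = 1 / (Nat.factorial n : ℝ) := by
  rw [Measure.real]
  unfold simplexΔ
  rw [volume_simplex n 1 zero_le_one, ENNReal.toReal_ofReal (by positivity), one_pow]
end simplexvol
section generic
open Filter Topology
open scoped ContDiff

/-- Hadamard quotient of `e` along the line through `x₀` with direction `v`. -/
noncomputable def hadQ {V A : Type} [NormedAddCommGroup V] [NormedSpace ℝ V]
    [NormedAddCommGroup A] [NormedSpace ℝ A] (e : V → A) (x₀ v : V) (s : ℝ) : A :=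
  ∫ u in Set.Icc (0 : ℝ) 1, fderiv ℝ e (x₀ + (u * s) • v) v

theorem hadQ_smooth {V A : Type} [NormedAddCommGroup V] [NormedSpace ℝ V]
    [NormedAddCommGroup A] [NormedSpace ℝ A] {e : V → A} (he : ContDiff ℝ ∞ e) (x₀ v : V) :
    ContDiff ℝ ∞ (hadQ e x₀ v) := by
  rw [contDiff_iff_contDiffAt]
  intro s
  have hd : ContDiff ℝ ∞ (fderiv ℝ e) := he.fderiv_right (by simp)
  have := param_smooth (volume : Measure ℝ) (isCompact_Icc (a := (0 : ℝ)) (b := 1))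
    (fun (s : ℝ) u => fderiv ℝ e (x₀ + (u * s) • v) v) s
    (Eventually.of_forall fun s u _ => by
      have : ContDiff ℝ ∞ (fun p : ℝ × ℝ => fderiv ℝ e (x₀ + (p.2 * p.1) • v) v) := by fun_prop
      exact this.contDiffAt)
  exact this.self_of_nhds

theorem hadQ_eq {V A : Type} [NormedAddCommGroup V] [NormedSpace ℝ V]
    [NormedAddCommGroup A] [NormedSpace ℝ A] [CompleteSpace A]
    {e : V → A} (he : ContDiff ℝ ∞ e) (x₀ v : V)
    (s : ℝ) : e (x₀ + s • v) = e x₀ + s • hadQ e x₀ v s := by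
  have hd : ContDiff ℝ ∞ (fderiv ℝ e) := he.fderiv_right (by simp)
  have hder : ∀ u ∈ Set.uIcc (0 : ℝ) 1, HasDerivAt (fun u : ℝ => e (x₀ + (u * s) • v))
      (s • fderiv ℝ e (x₀ + (u * s) • v) v) u := by
    intro u _
    have h1 : HasDerivAt (fun u : ℝ => x₀ + (u * s) • v) (s • v) u := by
      simpa using (((hasDerivAt_id u).mul_const s).smul_const v).const_add x₀
    have h2 := (he.differentiable (by simp) (x₀ + (u * s) • v)).hasFDerivAt
    have h3 := h2.comp_hasDerivAt u h1
    rw [map_smul] at h3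
    exact h3
  have hc : Continuous fun u : ℝ => s • fderiv ℝ e (x₀ + (u * s) • v) v := by
    have := hd.continuous
    fun_prop
  have := intervalIntegral.integral_eq_sub_of_hasDerivAt hder (hc.intervalIntegrable _ _)
  rw [intervalIntegral.integral_smul] at this
  unfold hadQ
  rw [integral_Icc_eq_integral_Ioc, ← intervalIntegral.integral_of_le zero_le_one, this]
  simp

theorem hadQ_zero {V A : Type} [NormedAddCommGroup V] [NormedSpace ℝ V]
    [NormedAddCommGroup A] [NormedSpace ℝ A] [CompleteSpace A] (e : V → A) (x₀ v : V) :
    hadQ e x₀ v 0 = fderiv ℝ e x₀ v := by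
  unfold hadQ
  simp

variable {A : Type} [NormedRing A] [NormedAlgebra ℂ A] [CompleteSpace A]

set_option linter.unusedSectionVars false

theorem list_prod_contDiffAt {E ι : Type} [NormedAddCommGroup E] [NormedSpace ℝ E]
    (l : List ι) (f : ι → E → A) (x : E) (h : ∀ i, ContDiffAt ℝ ∞ (f i) x) :
    ContDiffAt ℝ ∞ (fun y => (l.map fun i => f i y).prod) x := by
  induction l with
  | nil => simpa using contDiffAt_const
  | cons a l ih =>
    simp only [List.map_cons, List.prod_cons]
    exact (h a).mul ih

theorem list_prod_smul {ι : Type} (l : List ι) (c : ι → ℝ) (f : ι → A) :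
    (l.map fun i => c i • f i).prod = (l.map c).prod • (l.map f).prod := by
  induction l with
  | nil => simp
  | cons a l ih => simp [ih, smul_smul, mul_comm]

theorem generic_mixed {n : ℕ} {V : Type} [NormedAddCommGroup V] [NormedSpace ℝ V]
    (e : V → A) (he : ContDiff ℝ ∞ e) (hidem : ∀ x, e x * e x = e x) (x₀ : V)
    (v : Fin n → V) (τ : A →L[ℝ] ℂ) (b : ℂ) :
    iteratedFDeriv ℝ n (fun ε : Fin n → ℝ => b * ∫ t in simplexΔ n,
      ∑ σ : Equiv.Perm (Fin n), ((Equiv.Perm.sign σ : ℤ) : ℂ) *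
        τ (rieszF (e x₀ + ∑ i, t i • (e (x₀ + ε i • v i) - e x₀)) *
          ((List.finRange n).map fun i =>
            fderiv ℝ (fun t : Fin n → ℝ =>
              rieszF (e x₀ + ∑ i, t i • (e (x₀ + ε i • v i) - e x₀))) t
              (Pi.single (σ i) 1)).prod)) 0 (fun i => Pi.single i 1) =
    b * (1 / (Nat.factorial n : ℂ)) * ∑ σ : Equiv.Perm (Fin n),
      ((Equiv.Perm.sign σ : ℤ) : ℂ) *
        τ (e x₀ * ((List.finRange n).map fun i => fderiv ℝ e x₀ (v (σ i))).prod) := by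
  set h : Fin n → ℝ → A := fun i => hadQ e x₀ (v i) with hh
  have hhs : ∀ i, ContDiff ℝ ∞ (h i) := fun i => hadQ_smooth he x₀ (v i)
  have hsub : ∀ i s, e (x₀ + s • v i) - e x₀ = s • h i s := fun i s => by
    rw [hadQ_eq he x₀ (v i) s]; simp [hh]
  let a : (Fin n → ℝ) → (Fin n → ℝ) → A := fun ε t => e x₀ + ∑ i, t i • (ε i • h i (ε i))
  have has : ContDiff ℝ ∞ (fun p : (Fin n → ℝ) × (Fin n → ℝ) => a p.1 p.2) := by
    simp only [a]
    fun_prop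
  have ha0 : ∀ t, a 0 t = e x₀ := fun t => by simp [a]
  have hR := rieszF_smooth (hidem x₀)
  have hRa : ∀ᶠ ε in 𝓝 (0 : Fin n → ℝ), ∀ t ∈ simplexΔ n,
      ContDiffAt ℝ ∞ (rieszF (A := A)) (a ε t) := by
    apply (isCompact_simplexΔ n).eventually_forall_of_forall_eventually
    intro t _
    have hc : Tendsto (fun p : (Fin n → ℝ) × (Fin n → ℝ) => a p.1 p.2) (𝓝 (0, t)) (𝓝 (e x₀)) := by
      have := has.continuous.tendsto (0, t)
      simpa only [ha0] using this
    exact hc.eventually hR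
  let G : (Fin n → ℝ) → (Fin n → ℝ) → ℂ := fun ε t =>
    ∑ σ : Equiv.Perm (Fin n), ((Equiv.Perm.sign σ : ℤ) : ℂ) *
        τ (rieszF (a ε t) * ((List.finRange n).map fun i =>
          fderiv ℝ (rieszF (A := A)) (a ε t) (h (σ i) (ε (σ i)))).prod)
  have hG : ∀ᶠ ε in 𝓝 (0 : Fin n → ℝ), ∀ t ∈ simplexΔ n,
      ContDiffAt ℝ ∞ (Function.uncurry G) (ε, t) := by
    refine hRa.mono fun ε hε t ht => ?_
    have h1 := hε t ht
    have h2 : ContDiffAt ℝ ∞ (fderiv ℝ (rieszF (A := A))) (a ε t) := h1.fderiv_right (by simp)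
    have h3 : ContDiffAt ℝ ∞ (fun p : (Fin n → ℝ) × (Fin n → ℝ) => rieszF (a p.1 p.2)) (ε, t) :=
      ContDiffAt.comp (g := rieszF (A := A)) (ε, t) h1 has.contDiffAt
    have h4 : ContDiffAt ℝ ∞ (fun p : (Fin n → ℝ) × (Fin n → ℝ) =>
        fderiv ℝ (rieszF (A := A)) (a p.1 p.2)) (ε, t) :=
      ContDiffAt.comp (g := fderiv ℝ (rieszF (A := A))) (ε, t) h2 has.contDiffAt
    refine ContDiffAt.sum (f := fun (σ : Equiv.Perm (Fin n)) (p : (Fin n → ℝ) × (Fin n → ℝ)) =>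
      ((Equiv.Perm.sign σ : ℤ) : ℂ) *
        τ (rieszF (a p.1 p.2) * ((List.finRange n).map fun i =>
          fderiv ℝ (rieszF (A := A)) (a p.1 p.2) (h (σ i) (p.1 (σ i)))).prod)) fun σ _ => ?_
    refine contDiffAt_const.mul (τ.contDiff.contDiffAt.comp _ (h3.mul ?_))
    refine list_prod_contDiffAt (List.finRange n)
      (fun i (p : (Fin n → ℝ) × (Fin n → ℝ)) =>
        fderiv ℝ (rieszF (A := A)) (a p.1 p.2) (h (σ i) (p.1 (σ i)))) (ε, t) fun i => ?_
    refine h4.clm_apply ?_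
    have := hhs (σ i)
    fun_prop
  have hH := (param_smooth (volume : Measure (Fin n → ℝ)) (isCompact_simplexΔ n) G 0 hG).self_of_nhds
  have key := mixed_partial n id Function.injective_id
    (fun ε : Fin n → ℝ => b * ∫ t in simplexΔ n,
      ∑ σ : Equiv.Perm (Fin n), ((Equiv.Perm.sign σ : ℤ) : ℂ) *
        τ (rieszF (e x₀ + ∑ i, t i • (e (x₀ + ε i • v i) - e x₀)) *
          ((List.finRange n).map fun i =>
            fderiv ℝ (fun t : Fin n → ℝ =>
              rieszF (e x₀ + ∑ i, t i • (e (x₀ + ε i • v i) - e x₀))) t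
              (Pi.single (σ i) 1)).prod))
    (fun ε => b * ∫ t in simplexΔ n, G ε t) (contDiffAt_const.mul hH) ?_
  · refine Eq.trans key ?_
    have hRd : ∀ w, fderiv ℝ (rieszF (A := A)) (e x₀) (fderiv ℝ e x₀ w) = fderiv ℝ e x₀ w := by
      intro w
      have h1 : HasFDerivAt (rieszF (A := A)) (fderiv ℝ (rieszF (A := A)) (e x₀)) (e x₀) :=
        (hR.self_of_nhds.differentiableAt (by simp)).hasFDerivAt
      have h2 : HasFDerivAt e (fderiv ℝ e x₀) x₀ :=
        (he.differentiable (by simp) x₀).hasFDerivAt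
      have h3 := h1.comp x₀ h2
      have h4 : (rieszF (A := A)) ∘ e = e := funext fun x => rieszF_idem (hidem x)
      rw [h4] at h3
      exact (congrArg (fun M => M w) (h3.unique h2))
    have hG0 : ∀ t, G 0 t = ∑ σ : Equiv.Perm (Fin n), ((Equiv.Perm.sign σ : ℤ) : ℂ) *
        τ (e x₀ * ((List.finRange n).map fun i => fderiv ℝ e x₀ (v (σ i))).prod) := by
      intro t
      simp only [G, ha0, rieszF_idem (hidem x₀), Pi.zero_apply, hh, hadQ_zero, hRd]
    simp_rw [hG0]
    rw [setIntegral_const, volume_real_simplexΔ, Complex.real_smul]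
    push_cast
    ring
  · filter_upwards [hRa] with ε hε
    simp only [id]
    rw [← mul_smul_comm, ← integral_smul]
    congr 1
    refine setIntegral_congr_fun (isCompact_simplexΔ n).isClosed.measurableSet fun t ht => ?_
    simp only [G, Finset.smul_sum]
    refine Finset.sum_congr rfl fun σ _ => ?_
    simp only [hsub]
    have hfd : ∀ j : Fin n, fderiv ℝ (fun t : Fin n → ℝ => rieszF (a ε t)) t (Pi.single j 1) =
        ε j • fderiv ℝ (rieszF (A := A)) (a ε t) (h j (ε j)) := by
      intro j
      have h1 : HasFDerivAt (rieszF (A := A)) (fderiv ℝ (rieszF (A := A)) (a ε t)) (a ε t) :=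
        ((hε t ht).differentiableAt (by simp)).hasFDerivAt
      have h2 : HasFDerivAt (a ε) (∑ i, (ContinuousLinearMap.proj (R := ℝ)
          (φ := fun _ : Fin n => ℝ) i).smulRight (ε i • h i (ε i))) t := by
        refine HasFDerivAt.const_add _ ?_
        refine HasFDerivAt.fun_sum fun i _ => ?_
        exact (ContinuousLinearMap.proj (R := ℝ)
          (φ := fun _ : Fin n => ℝ) i).hasFDerivAt.smul_const (ε i • h i (ε i))
      have h3 := (h1.comp t h2).fderiv
      have h5 : (fun t : Fin n → ℝ => rieszF (a ε t)) = rieszF ∘ a ε := rfl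
      rw [h5, h3]
      simp [Pi.single_apply]
    change _ * τ (rieszF (a ε t) * ((List.finRange n).map fun i =>
      fderiv ℝ (fun t : Fin n → ℝ => rieszF (a ε t)) t (Pi.single (σ i) 1)).prod) = _
    simp only [hfd]
    rw [list_prod_smul (List.finRange n) (fun i => ε (σ i))]
    have hp : ((List.finRange n).map fun i => ε (σ i)).prod = ∏ i, ε i := by
      rw [← Equiv.prod_comp σ, Fin.prod_univ_def]
    rw [hp, mul_smul_comm, map_smul, mul_smul_comm]
end generic

theorem simplexComb_eq {n N : ℕ} (E : Fin (n + 1) → Matrix (Fin N) (Fin N) ℂ) (t : Fin n → ℝ) :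
    simplexComb E t = E 0 + ∑ i : Fin n, t i • (E i.succ - E 0) := by
  unfold simplexComb
  simp only [Complex.coe_smul, smul_sub, Finset.sum_sub_distrib, ← Finset.sum_smul, sub_smul,
    one_smul]
  abel

theorem rieszComb_eq {n N : ℕ} (E : Fin (n + 1) → Matrix (Fin N) (Fin N) ℂ) :
    rieszComb E = fun t => rieszF (E 0 + ∑ i : Fin n, t i • (E i.succ - E 0)) := by
  funext t
  unfold rieszComb rieszF
  simp only [simplexComb_eq, Matrix.nonsing_inv_eq_ringInverse]

/-- for a smooth family of self-adjoint idempotents `e` on `ℝᵈ` and `n` even,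
the mixed partial derivative at `ε = 0` of
`f(ε₁,…,εₙ) = Chⁿ(e(x₀), e(x₀+ε₁v₁), …, e(x₀+εₙvₙ))` equals
`bₙ (1/n!) Σ_σ sgn σ · tr(e(x₀) D_{v_{σ(1)}}e(x₀) ⋯ D_{v_{σ(n)}}e(x₀))`,
i.e. the image of `Chⁿ` in de Rham cohomology is the Chern–Weil form `bₙ Tr e(de)ⁿ`. -/
theorem chEven_mixed_partial_at_zero
    (N n d : ℕ) (hn : Even n)
    (e : (Fin d → ℝ) → Matrix (Fin N) (Fin N) ℂ)
    (hsm : ContDiff ℝ (⊤ : ℕ∞) e)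
    (hidem : ∀ x, e x * e x = e x) (hsa : ∀ x, (e x)ᴴ = e x)
    (x₀ : Fin d → ℝ) (v : Fin n → Fin d → ℝ) :
    iteratedFDeriv ℝ n
        (fun ε : Fin n → ℝ =>
          chEven n N (fun j => Fin.cases (e x₀) (fun i => e (x₀ + ε i • v i)) j))
        0 (fun i => Pi.single i 1) =
      evenChernConst n * (1 / (Nat.factorial n : ℂ)) *
        ∑ σ : Equiv.Perm (Fin n),
          ((Equiv.Perm.sign σ : ℤ) : ℂ) *
            Matrix.trace
              (e x₀ *
                (((List.finRange n).map fun i => fderiv ℝ e x₀ (v (σ i))).prod)) := by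
  have hfin : FiniteDimensional ℝ (Matrix (Fin N) (Fin N) ℂ) := 
    FiniteDimensional.trans ℝ ℂ (Matrix (Fin N) (Fin N) ℂ)
  let τ : Matrix (Fin N) (Fin N) ℂ →L[ℝ] ℂ :=
    LinearMap.toContinuousLinearMap ((Matrix.traceLinearMap (Fin N) ℂ ℂ).restrictScalars ℝ)
  have key := generic_mixed (n := n) e hsm hidem x₀ v τ (evenChernConst n)
  unfold chEven
  simp only [rieszComb_eq]
  exact key
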